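/- Let p(·) ∈ P^{log}(ℍⁿ) with 0 < p₋ ≤ p₊ < Q/α for some 0 < α < Q, and define q(·) by 1/q(z) = 1/p(z) − α/Q. Then ‖χ_B‖_{L^{q(·)}(ℍⁿ)} ≈ |B|^{−α/Q} ‖χ_B‖_{L^{p(·)}(ℍⁿ)} uniformly over all ρ-balls B of ℍⁿ. -/

import Mathlib

open MeasureTheory ENNReal Real Set

noncomputable section

namespace Heisenberg

variable (n : ℕ)

/-- The underlying space of the Heisenberg group `ℍⁿ = ℝ^{2n} × ℝ`. -/
abbrev Hei := (Fin (2*n) → ℝ) × ℝ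

variable {n}

/-- Index of the `i`-th coordinate of the first half. -/
def lo (i : Fin n) : Fin (2*n) := Fin.cast (two_mul n).symm (Fin.castAdd n i)

/-- Index of the `i`-th coordinate of the second half. -/
def hi (i : Fin n) : Fin (2*n) := Fin.cast (two_mul n).symm (Fin.natAdd n i)

/-- The bilinear form `xᵀ J y` with `J = (1/2)[[0,−Iₙ],[Iₙ,0]]`. -/
def symp (x y : Fin (2*n) → ℝ) : ℝ :=
  (1/2) * ∑ i : Fin n, (x (hi i) * y (lo i) - x (lo i) * y (hi i))

/-- The Heisenberg group law `(x,t)·(y,s) = (x+y, t+s+xᵀJy)`. -/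
def hmul (z w : Hei n) : Hei n := (z.1 + w.1, z.2 + w.2 + symp z.1 w.1)

/-- Inverse: `(x,t)⁻¹ = (−x,−t)`. -/
def hinv (z : Hei n) : Hei n := (-z.1, -z.2)

/-- The identity element `e = (0,0)`. -/
def he : Hei n := (0, 0)

/-- Anisotropic dilations `r·(x,t) = (rx, r²t)`. -/
def hdil (r : ℝ) (z : Hei n) : Hei n := (r • z.1, r^2 * z.2)

/-- The Koranyi norm `ρ(x,t) = (|x|⁴ + 16 t²)^{1/4}`. -/
def knorm (z : Hei n) : ℝ := ((∑ i, (z.1 i)^2)^2 + 16 * z.2^2) ^ (1/4 : ℝ)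

/-- The `ρ`-ball `B(z₀,δ) = {w : ρ(z₀⁻¹·w) < δ}`. -/
def kball (z₀ : Hei n) (δ : ℝ) : Set (Hei n) := {w | knorm (hmul (hinv z₀) w) < δ}

/-- The homogeneous dimension `Q = 2n+2`. -/
def Q (n : ℕ) : ℝ := 2*n+2

/-! ### Variable Lebesgue spaces -/

/-- The modular `∫ (g(z)/λ)^{p(z)} dz` (for `ℝ≥0∞`-valued `g`). -/
def modular (p : Hei n → ℝ) (g : Hei n → ℝ≥0∞) (lam : ℝ) : ℝ≥0∞ :=
  ∫⁻ z, (g z / ENNReal.ofReal lam) ^ (p z)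

/-- The Luxemburg norm on `L^{p(·)}(ℍⁿ)` for `ℝ≥0∞`-valued functions. -/
def vnormE (p : Hei n → ℝ) (g : Hei n → ℝ≥0∞) : ℝ :=
  sInf {lam : ℝ | 0 < lam ∧ modular p g lam ≤ 1}

/-- The Luxemburg norm `‖f‖_{L^{p(·)}(ℍⁿ)}`. -/
def vnorm (p : Hei n → ℝ) (f : Hei n → ℝ) : ℝ :=
  vnormE p (fun z => ENNReal.ofReal |f z|)

/-- Membership in the variable Lebesgue space (`ℝ≥0∞`-valued version). -/
def MemVLpE (p : Hei n → ℝ) (g : Hei n → ℝ≥0∞) : Prop :=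
  ∃ lam : ℝ, 0 < lam ∧ modular p g lam < ⊤

/-- Membership in `L^{p(·)}(ℍⁿ)`. -/
def MemVLp (p : Hei n → ℝ) (f : Hei n → ℝ) : Prop :=
  MemVLpE p (fun z => ENNReal.ofReal |f z|)

/-- The characteristic function of a set, `ℝ≥0∞`-valued. -/
def chiE (B : Set (Hei n)) : Hei n → ℝ≥0∞ := B.indicator fun _ => 1

/-- `‖χ_B‖_{L^{p(·)}}`. -/
def chiNorm (p : Hei n → ℝ) (B : Set (Hei n)) : ℝ := vnormE p (chiE B)

/-- `p₋`, the essential infimum of the exponent. -/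
def pminus (p : Hei n → ℝ) : ℝ := essInf p volume

/-- `p₊`, the essential supremum of the exponent. -/
def pplus (p : Hei n → ℝ) : ℝ := essSup p volume

/-- `p̲ = min{p₋, 1}`. -/
def punder (p : Hei n → ℝ) : ℝ := min (pminus p) 1

/-- The conjugate exponent `p′ = p/(p−1)`. -/
def conjExp (a : ℝ) : ℝ := a / (a - 1)

/-- Local log-Hölder continuity: `|p(z)−p(w)| ≤ C/(−log ρ(z⁻¹w))` for `ρ(z⁻¹w) ≤ 1/2`. -/
def LogHolderLocal (p : Hei n → ℝ) : Prop :=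
  ∃ C > 0, ∀ z w : Hei n, knorm (hmul (hinv z) w) ≤ 1/2 →
    |p z - p w| * (-Real.log (knorm (hmul (hinv z) w))) ≤ C

/-- log-Hölder decay at infinity: `|p(z) − p_∞| ≤ C_∞/log(e+ρ(z))`. -/
def LogDecay (p : Hei n → ℝ) (pinf : ℝ) : Prop :=
  ∃ C > 0, ∀ z : Hei n, |p z - pinf| * Real.log (Real.exp 1 + knorm z) ≤ C

/-- The class `P^{log}(ℍⁿ)`: measurable exponents with `0 < p₋ ≤ p₊ < ∞` satisfying both
log-Hölder conditions. -/
def IsPLog (p : Hei n → ℝ) : Prop :=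
  Measurable p ∧ 0 < pminus p ∧ (∃ M : ℝ, ∀ᵐ z ∂(volume : Measure (Hei n)), p z ≤ M) ∧
    LogHolderLocal p ∧ ∃ pinf : ℝ, LogDecay p pinf

/-! ### Maximal operators and weights -/

/-- The fractional maximal operator `M_α f(z) = sup_{B ∋ z} |B|^{α/Q−1} ∫_B |f|`
(`α = 0` gives the Hardy–Littlewood maximal operator). -/
def fracMax (α : ℝ) (f : Hei n → ℝ) (z : Hei n) : ℝ≥0∞ :=
  ⨆ (z₀ : Hei n) (δ : ℝ) (_ : 0 < δ) (_ : z ∈ kball z₀ δ),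
    volume (kball z₀ δ) ^ (α / Q n - 1) * ∫⁻ w in kball z₀ δ, ENNReal.ofReal |f w|

/-- A weight: positive a.e. and locally integrable. -/
def IsWeight (ω : Hei n → ℝ) : Prop :=
  Measurable ω ∧ (∀ᵐ z ∂(volume : Measure (Hei n)), 0 < ω z) ∧ LocallyIntegrable ω volume

/-- `ω(E) = ∫_E ω`. -/
def wInt (ω : Hei n → ℝ) (B : Set (Hei n)) : ℝ≥0∞ := ∫⁻ z in B, ENNReal.ofReal (ω z)

/-- The Muckenhoupt class `A₁`: `Mω ≤ C ω` a.e. -/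
def IsA1 (ω : Hei n → ℝ) : Prop :=
  IsWeight ω ∧ ∃ C > 0, ∀ᵐ z ∂(volume : Measure (Hei n)),
    fracMax 0 ω z ≤ ENNReal.ofReal (C * ω z)

/-- The Muckenhoupt class `A_p`, `p > 1`. -/
def IsAp (p : ℝ) (ω : Hei n → ℝ) : Prop :=
  IsWeight ω ∧ ∃ C > 0, ∀ (z₀ : Hei n) (δ : ℝ), 0 < δ →
    wInt ω (kball z₀ δ) * wInt (fun z => ω z ^ (-(1/(p-1)))) (kball z₀ δ) ^ (p-1)
      ≤ ENNReal.ofReal C * volume (kball z₀ δ) ^ p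

/-- Membership in `A_s` for `s ≥ 1` (`A₁` when `s = 1`). -/
def MemA (s : ℝ) (ω : Hei n → ℝ) : Prop :=
  (s = 1 ∧ IsA1 ω) ∨ (1 < s ∧ IsAp s ω)

/-- The reverse doubling condition (RD). -/
def ReverseDoubling (ω : Hei n → ℝ) : Prop :=
  ∃ a ∈ Ioo (0:ℝ) 1, ∃ b ∈ Ioo (0:ℝ) 1, ∀ (z : Hei n) (δ₁ δ₂ : ℝ), 0 < δ₁ → δ₁ < δ₂ →
    volume (kball z δ₁) ≤ ENNReal.ofReal a * volume (kball z δ₂) →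
    wInt ω (kball z δ₁) ≤ ENNReal.ofReal b * wInt ω (kball z δ₂)

/-- The class `A_{p,q}` of weights, `1 < p ≤ q < ∞`. -/
def IsApq (p q : ℝ) (ω : Hei n → ℝ) : Prop :=
  IsWeight ω ∧ ∃ C > 0, ∀ (z₀ : Hei n) (δ : ℝ), 0 < δ →
    wInt (fun z => ω z ^ q) (kball z₀ δ) ^ (1/q) *
      wInt (fun z => ω z ^ (-conjExp p)) (kball z₀ δ) ^ (1/conjExp p)
      ≤ ENNReal.ofReal C * volume (kball z₀ δ) ^ (1/q + 1/conjExp p)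

/-! ### Invariant derivatives, Schwartz seminorms, Hardy spaces -/

/-- The element of `ℍⁿ` with the value `s` in the `i`-th coordinate and `0` elsewhere. -/
def coordVec (i : Fin (2*n+1)) (s : ℝ) : Hei n :=
  if h : (i : ℕ) < 2*n then (fun j => if j = ⟨i, h⟩ then s else 0, 0) else (0, s)

/-- Left-invariant vector field: `(X_i f)(z) = d/ds f(z · s e_i)|_{s=0}`. -/
def XDeriv (i : Fin (2*n+1)) (f : Hei n → ℝ) (z : Hei n) : ℝ :=
  deriv (fun s : ℝ => f (hmul z (coordVec i s))) 0

/-- Right-invariant vector field: `(X̃_i f)(z) = d/ds f(s e_i · z)|_{s=0}`. -/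
def XtDeriv (i : Fin (2*n+1)) (f : Hei n → ℝ) (z : Hei n) : ℝ :=
  deriv (fun s : ℝ => f (hmul (coordVec i s) z)) 0

/-- Higher-order left-invariant derivative `X^I = X₁^{i₁} ⋯ X_{2n+1}^{i_{2n+1}}`. -/
def XI (I : Fin (2*n+1) → ℕ) : (Hei n → ℝ) → (Hei n → ℝ) :=
  ((List.finRange (2*n+1)).map fun i => (XDeriv i)^[I i]).foldr (· ∘ ·) id

/-- Higher-order right-invariant derivative `X̃^I`. -/
def XtI (I : Fin (2*n+1) → ℕ) : (Hei n → ℝ) → (Hei n → ℝ) :=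
  ((List.finRange (2*n+1)).map fun i => (XtDeriv i)^[I i]).foldr (· ∘ ·) id

/-- The homogeneous degree `d(I) = i₁ + ⋯ + i_{2n} + 2 i_{2n+1}`. -/
def homDeg (I : Fin (2*n+1) → ℕ) : ℕ :=
  (∑ i : Fin (2*n), I (Fin.castSucc i)) + 2 * I (Fin.last (2*n))

/-- The monomial `z^I = x₁^{i₁} ⋯ x_{2n}^{i_{2n}} t^{i_{2n+1}}`. -/
def monomial (I : Fin (2*n+1) → ℕ) (z : Hei n) : ℝ :=
  (∏ i : Fin (2*n), z.1 i ^ I (Fin.castSucc i)) * z.2 ^ I (Fin.last (2*n))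

/-- The Schwartz seminorm `‖φ‖_{S,L} = Σ_{d(I) ≤ L} sup_z (1+ρ(z))^{(L+1)(Q+1)} |X^I φ(z)|`. -/
def schwartzSemi (L : ℕ) (φ : Hei n → ℝ) : ℝ :=
  ∑ I : Fin (2*n+1) → Fin (L+1),
    if homDeg (fun i => (I i : ℕ)) ≤ L then
      ⨆ z : Hei n, (1 + knorm z) ^ ((L+1)*(2*n+3)) * |XI (fun i => (I i : ℕ)) φ z|
    else 0

/-- Schwartz functions on `ℍⁿ`. -/
def IsSchwartz (φ : Hei n → ℝ) : Prop :=
  ContDiff ℝ (⊤ : ℕ∞) φ ∧ ∀ (L : ℕ) (I : Fin (2*n+1) → ℕ), ∃ C : ℝ, ∀ z,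
    (1 + knorm z) ^ L * |XI I φ z| ≤ C

/-- Convolution `(f ∗ g)(z) = ∫ f(w) g(w⁻¹·z) dw`. -/
def conv (f g : Hei n → ℝ) (z : Hei n) : ℝ := ∫ w, f w * g (hmul (hinv w) z)

/-- The dilate `φ_t(z) = t^{−Q} φ(t⁻¹·z)`. -/
def dilPhi (t : ℝ) (φ : Hei n → ℝ) (z : Hei n) : ℝ := t ^ (-(Q n)) * φ (hdil t⁻¹ z)

/-- The grand maximal function `M_L f(z) = sup_{t>0} sup_{‖φ‖_{S,L} ≤ 1} |(f∗φ_t)(z)|`. -/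
def grandMax (L : ℕ) (f : Hei n → ℝ) (z : Hei n) : ℝ≥0∞ :=
  ⨆ (t : ℝ) (_ : 0 < t) (φ : Hei n → ℝ) (_ : IsSchwartz φ) (_ : schwartzSemi L φ ≤ 1),
    ENNReal.ofReal |conv f (dilPhi t φ) z|

/-- `D_{p(·)} = min{k ≥ 0 : (2n+k+3) p₋ > 2n+2}`. -/
def Dexp (p : Hei n → ℝ) : ℕ :=
  sInf {k : ℕ | (2*(n:ℝ)+2) < (2*(n:ℝ)+(k:ℝ)+3) * pminus p}

/-- The order `L = D_{p(·)} + Q + 3` of the grand maximal function defining `H^{p(·)}`. -/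
def hardyIndex (p : Hei n → ℝ) : ℕ := Dexp p + (2*n+2) + 3

/-- The Hardy norm `‖f‖_{H^{p(·)}} = ‖M_L f‖_{L^{p(·)}}`. -/
def hnorm (p : Hei n → ℝ) (f : Hei n → ℝ) : ℝ := vnormE p (grandMax (hardyIndex p) f)

/-- Membership in the variable Hardy space `H^{p(·)}(ℍⁿ)`. -/
def MemHardy (p : Hei n → ℝ) (f : Hei n → ℝ) : Prop :=
  MemVLpE p (grandMax (hardyIndex p) f)

/-- A `(p(·), p₀, D)`-atom supported in the ball `B(z₀, δ)`. -/
structure IsAtom (p : Hei n → ℝ) (p₀ : ℝ) (D : ℕ) (a : Hei n → ℝ) (z₀ : Hei n) (δ : ℝ) :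
    Prop where
  meas : Measurable a
  supp : ∀ z, z ∉ kball z₀ δ → a z = 0
  size : eLpNorm a (ENNReal.ofReal p₀) volume ≤
    volume (kball z₀ δ) ^ (1/p₀) / ENNReal.ofReal (chiNorm p (kball z₀ δ))
  vanish : ∀ I : Fin (2*n+1) → ℕ, homDeg I ≤ D → ∫ z, a z * monomial I z = 0

/-- The bounded intersection property for a family of sets. -/
def BoundedIntersection (B : ℕ → Set (Hei n)) : Prop :=
  ∃ K : ℕ, ∀ (z : Hei n) (s : Finset ℕ), (∀ j ∈ s, z ∈ B j) → s.card ≤ K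

/-- The quantity `A({λ_j},{B_j},p(·))` with `B_j = B(c_j, d_j)`. -/
def Acal (p : Hei n → ℝ) (lam : ℕ → ℝ) (c : ℕ → Hei n) (d : ℕ → ℝ) : ℝ :=
  vnormE p (fun z => (∑' j,
    ((ENNReal.ofReal (lam j) / ENNReal.ofReal (chiNorm p (kball (c j) (d j)))) *
      chiE (kball (c j) (d j)) z) ^ punder p) ^ (1 / punder p))

/-- Size and smoothness bounds of a kernel of type `(α, N)`:
`C^N` off the origin and `|X̃^I K(z)| ≲ ρ(z)^{α−Q−d(I)}` for `d(I) ≤ N`. -/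
def KernelBounds (α : ℝ) (N : ℕ) (K : Hei n → ℝ) : Prop :=
  ContDiffOn ℝ N K {z : Hei n | z ≠ he} ∧
  ∃ C > 0, ∀ I : Fin (2*n+1) → ℕ, homDeg I ≤ N → ∀ z : Hei n, z ≠ he →
    |XtI I K z| ≤ C * knorm z ^ (α - Q n - homDeg I)

/-- A kernel of type `(α, N)`; for `α = 0` one additionally requires the `L²` bound
`‖f ∗ K‖₂ ≲ ‖f‖₂` for Schwartz functions `f`. -/
def KernelType (α : ℝ) (N : ℕ) (K : Hei n → ℝ) : Prop :=
  KernelBounds α N K ∧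
  (α = 0 → ∃ C > 0, ∀ f : Hei n → ℝ, IsSchwartz f →
    eLpNorm (conv f K) 2 volume ≤ ENNReal.ofReal C * eLpNorm f 2 volume)

/-! ### Koranyi balls -/

lemma knorm_nonneg (z : Hei n) : 0 ≤ knorm z := by
  unfold knorm; positivity

lemma knorm_lt_iff (z : Hei n) {δ : ℝ} (hδ : 0 < δ) :
    knorm z < δ ↔ (∑ i, (z.1 i)^2)^2 + 16 * z.2^2 < δ ^ 4 := by
  unfold knorm
  rw [one_div, Real.rpow_inv_lt_iff_of_pos (by positivity) hδ.le (by norm_num)]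
  norm_cast

lemma Q_pos (n : ℕ) : 0 < Q n := by
  unfold Q; positivity

lemma kball_he (δ : ℝ) : kball (he : Hei n) δ = {w | knorm w < δ} := by
  ext w
  simp [kball, hmul, hinv, he, symp]

lemma continuous_symp_right (x : Fin (2*n) → ℝ) : Continuous (symp x) := by
  unfold symp; fun_prop

lemma isOpen_kball (z₀ : Hei n) {δ : ℝ} (hδ : 0 < δ) : IsOpen (kball z₀ δ) := by
  simp only [kball, knorm_lt_iff _ hδ, hmul, symp]
  exact isOpen_lt (by fun_prop) continuous_const

lemma measurePreserving_hmul (z₀ : Hei n) :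
    MeasurePreserving (hmul z₀) (volume : Measure (Hei n)) volume := by
  refine MeasurePreserving.skew_product (f := fun x => z₀.1 + x)
    (g := fun x t => z₀.2 + t + symp z₀.1 x) (measurePreserving_add_left volume z₀.1) ?_ ?_
  · have := (continuous_symp_right z₀.1).measurable
    unfold Function.uncurry
    fun_prop
  · refine Filter.Eventually.of_forall fun x => ?_
    have h := (measurePreserving_add_left (volume : Measure ℝ) (z₀.2 + symp z₀.1 x)).map_eq
    have he : (fun t => z₀.2 + t + symp z₀.1 x) = fun t => z₀.2 + symp z₀.1 x + t := by
      funext t; ring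
    rwa [← he] at h

lemma volume_kball_eq_he (z₀ : Hei n) {δ : ℝ} (hδ : 0 < δ) :
    volume (kball z₀ δ) = volume (kball (he : Hei n) δ) := by
  rw [← (measurePreserving_hmul (hinv z₀)).measure_preimage
    (isOpen_kball he hδ).measurableSet.nullMeasurableSet, kball_he]
  rfl

/-- The dilation as a linear map. -/
def hdilLin (r : ℝ) : Hei n →ₗ[ℝ] Hei n :=
  (r • LinearMap.id).prodMap ((r ^ 2) • LinearMap.id)

lemma det_hdilLin (r : ℝ) : LinearMap.det (hdilLin (n := n) r) = r ^ (2 * n + 2) := by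
  rw [hdilLin, LinearMap.det_prodMap, LinearMap.det_smul, LinearMap.det_smul]
  simp [pow_add]

lemma kball_he_eq_preimage {δ : ℝ} (hδ : 0 < δ) :
    kball (he : Hei n) δ = hdilLin δ⁻¹ ⁻¹' kball (he : Hei n) 1 := by
  ext z
  simp only [kball_he, mem_ofPred_eq, mem_preimage, knorm_lt_iff _ hδ, knorm_lt_iff _ one_pos,
    hdilLin, LinearMap.prodMap_apply, LinearMap.smul_apply, LinearMap.id_apply, Pi.smul_apply,
    smul_eq_mul, mul_pow, ← Finset.mul_sum, one_pow]
  have h : (δ⁻¹ ^ 2) ^ 2 * (∑ i, z.1 i ^ 2) ^ 2 + 16 * ((δ⁻¹ ^ 2) ^ 2 * z.2 ^ 2)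
      = ((∑ i, z.1 i ^ 2) ^ 2 + 16 * z.2 ^ 2) / δ ^ 4 := by
    field_simp
  rw [h, div_lt_one (by positivity)]

lemma volume_kball_one_ne_top : volume (kball (he : Hei n) 1) ≠ ⊤ := by
  refine ((Metric.isBounded_iff_subset_closedBall (0 : Hei n)).2 ⟨1, ?_⟩).measure_lt_top.ne
  intro z hz
  rw [kball_he, mem_ofPred_eq, knorm_lt_iff _ one_pos] at hz
  have h0 : 0 ≤ ∑ i, z.1 i ^ 2 := Finset.sum_nonneg fun i _ => sq_nonneg _
  have hs : ∑ i, z.1 i ^ 2 ≤ 1 := by nlinarith [sq_nonneg z.2]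
  rw [mem_closedBall_zero_iff, Prod.norm_def, max_le_iff, pi_norm_le_iff_of_nonneg zero_le_one]
  refine ⟨fun i => ?_, ?_⟩
  · rw [Real.norm_eq_abs, ← sq_le_one_iff_abs_le_one]
    exact (Finset.single_le_sum (f := fun i => z.1 i ^ 2) (fun i _ => sq_nonneg _)
      (Finset.mem_univ i)).trans hs
  · rw [Real.norm_eq_abs, ← sq_le_one_iff_abs_le_one]
    nlinarith [sq_nonneg (∑ i, z.1 i ^ 2)]

lemma volume_kball_one_pos : 0 < volume (kball (he : Hei n) 1) := by
  refine (isOpen_kball he one_pos).measure_pos _ ⟨0, ?_⟩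
  rw [kball_he, mem_ofPred_eq, knorm_lt_iff _ one_pos]
  simp

/-- The volume of the unit ball. -/
def ballConst (n : ℕ) : ℝ := (volume (kball (he : Hei n) 1)).toReal

lemma ballConst_pos (n : ℕ) : 0 < ballConst n :=
  ENNReal.toReal_pos volume_kball_one_pos.ne' volume_kball_one_ne_top

lemma volume_kball (z₀ : Hei n) {δ : ℝ} (hδ : 0 < δ) :
    volume (kball z₀ δ) = ENNReal.ofReal (ballConst n * δ ^ Q n) := by
  have hHaar : (volume : Measure (Hei n)).IsAddHaarMeasure := by
    rw [Measure.volume_eq_prod]; infer_instance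
  have hdet : LinearMap.det (hdilLin (n := n) δ⁻¹) ≠ 0 := by
    rw [det_hdilLin]; positivity
  have hQ : δ ^ Q n = δ ^ (2 * n + 2) := by
    rw [← Real.rpow_natCast]; simp [Q]
  have habs : |((δ⁻¹ : ℝ) ^ (2 * n + 2))⁻¹| = δ ^ Q n := by
    rw [hQ, inv_pow, inv_inv, abs_of_pos (by positivity)]
  rw [volume_kball_eq_he z₀ hδ, kball_he_eq_preimage hδ,
    Measure.addHaar_preimage_linearMap _ hdet, det_hdilLin, habs, mul_comm,
    ENNReal.ofReal_mul (ballConst_pos n).le, ballConst,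
    ENNReal.ofReal_toReal volume_kball_one_ne_top]

lemma eq_of_knorm_eq_zero {z w : Hei n} (h : knorm (hmul (hinv z) w) = 0) : z = w := by
  have h4 : ∀ δ > 0, (∑ i, (w.1 i - z.1 i)^2)^2 +
      16 * (hmul (hinv z) w).2^2 < δ ^ 4 := by
    intro δ hδ
    have := (knorm_lt_iff _ hδ).1 (h.trans_lt hδ)
    simpa [hmul, hinv, neg_add_eq_sub] using this
  have hS : 0 ≤ ∑ i, (w.1 i - z.1 i)^2 := Finset.sum_nonneg fun i _ => sq_nonneg _
  have h0 : (∑ i, (w.1 i - z.1 i)^2)^2 + 16 * (hmul (hinv z) w).2^2 ≤ 0 := by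
    by_contra! hc
    have := h4 (((∑ i, (w.1 i - z.1 i)^2)^2 + 16 * (hmul (hinv z) w).2^2) ^ (1 / 4 : ℝ))
      (by positivity)
    rw [← Real.rpow_mul_natCast hc.le] at this
    norm_num at this
  have hS0 : ∑ i, (w.1 i - z.1 i)^2 = 0 := by
    have := sq_nonneg (hmul (hinv z) w).2
    have h' : (∑ i, (w.1 i - z.1 i)^2)^2 = 0 := by nlinarith [sq_nonneg (∑ i, (w.1 i - z.1 i)^2)]
    simpa using h'
  have h1 : z.1 = w.1 := by
    funext i
    have := (Finset.sum_eq_zero_iff_of_nonneg fun i _ => sq_nonneg (w.1 i - z.1 i)).1 hS0 i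
      (Finset.mem_univ i)
    nlinarith [pow_eq_zero_iff (two_ne_zero) |>.1 this]
  have h2 : (hmul (hinv z) w).2 = 0 := by
    have : (hmul (hinv z) w).2 ^ 2 = 0 := by
      nlinarith [sq_nonneg (hmul (hinv z) w).2, sq_nonneg (∑ i, (w.1 i - z.1 i)^2)]
    simpa using this
  have hsymp : symp (-z.1) w.1 = 0 := by
    rw [← h1]; simp [symp, mul_comm]
  refine Prod.ext h1 ?_
  simp only [hmul, hinv, hsymp] at h2
  linarith

/-! ### Norms of characteristic functions -/

lemma modular_chiE {p : Hei n → ℝ} {B : Set (Hei n)} (hB : MeasurableSet B)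
    (hp : ∀ᵐ z ∂(volume : Measure (Hei n)), 0 < p z) {lam : ℝ} (hlam : 0 < lam) :
    modular p (chiE B) lam = ∫⁻ z in B, ENNReal.ofReal (lam⁻¹ ^ p z) := by
  rw [modular, ← lintegral_indicator hB]
  refine lintegral_congr_ae ?_
  filter_upwards [hp] with z hz
  by_cases hzB : z ∈ B
  · rw [indicator_of_mem hzB, chiE, indicator_of_mem hzB, one_div,
      ← ENNReal.ofReal_inv_of_pos hlam, ENNReal.ofReal_rpow_of_pos (by positivity)]
  · simp [chiE, hzB, hz]

/-- If `p` is, in a logarithmic sense relative to `|B|`, close to a constant `P` on a large part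
of `B`, then `‖χ_B‖_{L^{p(·)}} ≈ |B|^{1/P}`. -/
lemma chiNorm_equiv_of_close {p : Hei n → ℝ} {m M L P V : ℝ} {B G : Set (Hei n)}
    (hm : 0 < m) (hp : ∀ᵐ z ∂(volume : Measure (Hei n)), m ≤ p z ∧ p z ≤ M)
    (hP : m ≤ P) (hPM : P ≤ M) (hV : 0 < V) (hB : MeasurableSet B) (hG : MeasurableSet G)
    (hBV : volume B = ENNReal.ofReal V)
    (hclose : ∀ᵐ z ∂(volume : Measure (Hei n)), z ∈ B ∩ G →
      |1 / p z - 1 / P| * |Real.log V| ≤ L)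
    (hbad : volume (B \ G) = 0 ∨ (1 ≤ V ∧ volume (B \ G) ≤ ENNReal.ofReal (V ^ (m / M) / 2))) :
    (Real.exp (-(M * L)) / 4) ^ (1 / m) * V ^ (1 / P) ≤ chiNorm p B ∧
      chiNorm p B ≤ (Real.exp (M * L) + 1) ^ (1 / m) * V ^ (1 / P) := by
  have hP0 : 0 < P := hm.trans_le hP
  have hM0 : 0 < M := hP0.trans_le hPM
  have hp0 : ∀ᵐ z ∂(volume : Measure (Hei n)), 0 < p z := hp.mono fun z hz => hm.trans_le hz.1
  have hbounds : ∀ᵐ z ∂(volume : Measure (Hei n)), z ∈ B ∩ G →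
      Real.exp (-(M * L)) * V⁻¹ ≤ (V ^ (1 / P))⁻¹ ^ p z ∧
      (V ^ (1 / P))⁻¹ ^ p z ≤ Real.exp (M * L) * V⁻¹ := by
    filter_upwards [hp, hclose] with z hz hc hzBG
    have hpz : 0 < p z := hm.trans_le hz.1
    have hc := hc hzBG
    rw [← abs_mul] at hc
    have hL : 0 ≤ L := (abs_nonneg _).trans hc
    have hid : (V ^ (1 / P))⁻¹ ^ p z =
        Real.exp (p z * ((1 / p z - 1 / P) * Real.log V)) * V⁻¹ := by
      rw [← Real.rpow_neg hV.le, ← Real.rpow_mul hV.le, Real.rpow_def_of_pos hV]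
      nth_rw 3 [← Real.exp_log hV]
      rw [← Real.exp_neg, ← Real.exp_add]
      congr 1
      field_simp
      ring
    have habs : |p z * ((1 / p z - 1 / P) * Real.log V)| ≤ M * L := by
      rw [abs_mul, abs_of_pos hpz]
      exact mul_le_mul hz.2 hc (abs_nonneg _) hM0.le
    rw [hid]
    have := abs_le.1 habs
    exact ⟨mul_le_mul_of_nonneg_right (Real.exp_le_exp.2 this.1) (by positivity),
      mul_le_mul_of_nonneg_right (Real.exp_le_exp.2 this.2) (by positivity)⟩
  have hVP : 0 < V ^ (1 / P) := by positivity
  have hup : ∀ c : ℝ, 1 ≤ c → modular p (chiE B) (c * V ^ (1 / P)) ≤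
      ENNReal.ofReal (c⁻¹ ^ m * (Real.exp (M * L) + 1)) := by
    intro c hc
    have hc0 : 0 < c := one_pos.trans_le hc
    have hcp : ∀ z, m ≤ p z → c⁻¹ ^ p z ≤ c⁻¹ ^ m := fun z hz =>
      Real.rpow_le_rpow_of_exponent_ge (by positivity) (inv_le_one_of_one_le₀ hc) hz
    rw [modular_chiE hB hp0 (by positivity), ← lintegral_inter_add_sdiff _ B hG, mul_add,
      ENNReal.ofReal_add (by positivity) (by positivity)]
    refine add_le_add ?_ ?_
    · calc ∫⁻ z in B ∩ G, ENNReal.ofReal ((c * V ^ (1 / P))⁻¹ ^ p z)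
          ≤ ∫⁻ _ in B ∩ G, ENNReal.ofReal (c⁻¹ ^ m * (Real.exp (M * L) * V⁻¹)) := by
            refine setLIntegral_mono_ae' (hB.inter hG) ?_
            filter_upwards [hp, hbounds] with z hz hb hzBG
            refine ENNReal.ofReal_le_ofReal ?_
            rw [mul_inv, Real.mul_rpow (by positivity) (by positivity)]
            exact mul_le_mul (hcp z hz.1) (hb hzBG).2 (by positivity) (by positivity)
        _ ≤ ENNReal.ofReal (c⁻¹ ^ m * (Real.exp (M * L) * V⁻¹)) * volume B := by
            rw [setLIntegral_const]
            gcongr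
            exact inter_subset_left
        _ = ENNReal.ofReal (c⁻¹ ^ m * Real.exp (M * L)) := by
            rw [hBV, ← ENNReal.ofReal_mul (by positivity)]
            congr 1
            field_simp
    · rcases hbad with h0 | ⟨hV1, hbad⟩
      · rw [setLIntegral_measure_zero _ _ h0]
        exact zero_le
      calc ∫⁻ z in B \ G, ENNReal.ofReal ((c * V ^ (1 / P))⁻¹ ^ p z)
          ≤ ∫⁻ _ in B \ G, ENNReal.ofReal (c⁻¹ ^ m * (V ^ (m / M))⁻¹) := by
            refine setLIntegral_mono_ae' (hB.diff hG) ?_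
            filter_upwards [hp] with z hz _
            refine ENNReal.ofReal_le_ofReal ?_
            rw [mul_inv, Real.mul_rpow (by positivity) (by positivity)]
            refine mul_le_mul (hcp z hz.1) ?_ (by positivity) (by positivity)
            rw [Real.inv_rpow (by positivity), ← Real.rpow_mul hV.le]
            refine inv_anti₀ (by positivity) (Real.rpow_le_rpow_of_exponent_le hV1 ?_)
            rw [one_div_mul_eq_div]
            exact div_le_div₀ (hm.le.trans hz.1) hz.1 hP0 hPM
        _ ≤ ENNReal.ofReal (c⁻¹ ^ m * (V ^ (m / M))⁻¹) * ENNReal.ofReal (V ^ (m / M) / 2) := by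
            rw [setLIntegral_const]
            gcongr
        _ ≤ ENNReal.ofReal (c⁻¹ ^ m * 1) := by
            rw [← ENNReal.ofReal_mul (by positivity)]
            refine ENNReal.ofReal_le_ofReal ?_
            rw [mul_assoc]
            gcongr
            have : (0:ℝ) < V ^ (m / M) := by positivity
            field_simp
            norm_num
  have hmem : (Real.exp (M * L) + 1) ^ (1 / m) * V ^ (1 / P) ∈
      {lam : ℝ | 0 < lam ∧ modular p (chiE B) lam ≤ 1} := by
    refine ⟨by positivity, (hup _ ?_).trans ?_⟩
    · exact Real.one_le_rpow (by linarith [Real.exp_pos (M * L)]) (by positivity)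
    · rw [Real.inv_rpow (by positivity), ← Real.rpow_mul (by positivity),
        one_div_mul_cancel hm.ne', Real.rpow_one, inv_mul_cancel₀ (by positivity)]
      simp
  refine ⟨le_csInf ⟨_, hmem⟩ ?_, csInf_le ⟨0, fun _ h => h.1.le⟩ hmem⟩
  rintro lam ⟨hlam, hmod⟩
  by_contra! hlt
  set c := (Real.exp (-(M * L)) / 4) ^ (1 / m) with hc
  have hc0 : 0 < c := by positivity
  have hhalf : ENNReal.ofReal (V / 2) ≤ volume (B ∩ G) := by
    have hle : volume (B \ G) ≤ ENNReal.ofReal (V / 2) := by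
      rcases hbad with h0 | ⟨hV1, hbad⟩
      · simp [h0]
      · refine hbad.trans (ENNReal.ofReal_le_ofReal ?_)
        have : V ^ (m / M) ≤ V ^ (1 : ℝ) :=
          Real.rpow_le_rpow_of_exponent_le hV1 ((div_le_one hM0).2 (hP.trans hPM))
        rw [Real.rpow_one] at this
        linarith
    have hsum : volume (B ∩ G) + volume (B \ G) =
        ENNReal.ofReal (V / 2) + ENNReal.ofReal (V / 2) := by
      rw [measure_inter_add_sdiff B hG, hBV, ← ENNReal.ofReal_add (by positivity) (by positivity)]
      congr 1
      ring
    by_contra! hlt'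
    exact (ENNReal.add_lt_add_of_lt_of_le (hle.trans_lt ENNReal.ofReal_lt_top).ne hlt' hle).ne hsum
  have hL : 0 ≤ L := by
    have hne : volume (B ∩ G) ≠ 0 :=
      ((ENNReal.ofReal_pos.2 (by positivity)).trans_le hhalf).ne'
    obtain ⟨z, hz, hzc⟩ :=
      ((frequently_ae_mem_iff.2 hne).and_eventually hclose).exists
    exact (by positivity : (0:ℝ) ≤ _).trans (hzc hz)
  have hc1 : c ≤ 1 := by
    refine Real.rpow_le_one (by positivity) ?_ (by positivity)
    have : Real.exp (-(M * L)) ≤ 1 := Real.exp_le_one_iff.2 (by nlinarith)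
    linarith
  have hlow : ENNReal.ofReal (c⁻¹ ^ m * (Real.exp (-(M * L)) / 2)) ≤ modular p (chiE B) lam := by
    rw [modular_chiE hB hp0 hlam]
    calc ENNReal.ofReal (c⁻¹ ^ m * (Real.exp (-(M * L)) / 2))
        = ENNReal.ofReal (c⁻¹ ^ m * (Real.exp (-(M * L)) * V⁻¹)) * ENNReal.ofReal (V / 2) := by
          rw [← ENNReal.ofReal_mul (by positivity)]
          congr 1
          field_simp
      _ ≤ ∫⁻ _ in B ∩ G, ENNReal.ofReal (c⁻¹ ^ m * (Real.exp (-(M * L)) * V⁻¹)) := by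
          rw [setLIntegral_const]
          gcongr
      _ ≤ ∫⁻ z in B ∩ G, ENNReal.ofReal (lam⁻¹ ^ p z) := by
          refine setLIntegral_mono_ae' (hB.inter hG) ?_
          filter_upwards [hp, hbounds] with z hz hb hzBG
          refine ENNReal.ofReal_le_ofReal ?_
          have h1 : c⁻¹ ^ m ≤ c⁻¹ ^ p z :=
            Real.rpow_le_rpow_of_exponent_le ((one_le_inv₀ hc0).2 hc1) hz.1
          calc c⁻¹ ^ m * (Real.exp (-(M * L)) * V⁻¹)
              ≤ c⁻¹ ^ p z * (V ^ (1 / P))⁻¹ ^ p z :=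
                mul_le_mul h1 (hb hzBG).1 (by positivity) (by positivity)
            _ = ((c * V ^ (1 / P))⁻¹) ^ p z := by
                rw [mul_inv, Real.mul_rpow (by positivity) (by positivity)]
            _ ≤ lam⁻¹ ^ p z := by
                refine Real.rpow_le_rpow (by positivity) (inv_anti₀ hlam hlt.le)
                  (hm.le.trans hz.1)
      _ ≤ ∫⁻ z in B, ENNReal.ofReal (lam⁻¹ ^ p z) := lintegral_mono_set inter_subset_left
  have hcm : c⁻¹ ^ m * (Real.exp (-(M * L)) / 2) = 2 := by
    rw [Real.inv_rpow hc0.le, hc, ← Real.rpow_mul (by positivity),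
      one_div_mul_cancel hm.ne', Real.rpow_one]
    have := Real.exp_pos (-(M * L))
    field_simp
    norm_num
  rw [hcm] at hlow
  have : ENNReal.ofReal 2 ≤ ENNReal.ofReal 1 := by simpa using hlow.trans hmod
  rw [ENNReal.ofReal_le_ofReal_iff zero_le_one] at this
  norm_num at this

/-! ### Consequences of the log-Hölder conditions -/

lemma IsPLog.exists_bounds {p : Hei n → ℝ} (hp : IsPLog p) {A : ℝ} (hA : pplus p < A) :
    ∃ m M : ℝ, 0 < m ∧ m ≤ M ∧ M < A ∧
      ∀ᵐ z ∂(volume : Measure (Hei n)), m ≤ p z ∧ p z ≤ M := by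
  obtain ⟨-, hpm, hbdd, -, -⟩ := hp
  obtain ⟨m, hm, hmp⟩ : ∃ m, 0 < m ∧ ∀ᵐ z ∂(volume : Measure (Hei n)), m ≤ p z := by
    rw [pminus, essInf, Filter.liminf_eq] at hpm
    have hne : {a | ∀ᵐ z ∂(volume : Measure (Hei n)), a ≤ p z}.Nonempty := by
      by_contra! h
      rw [h, Real.sSup_empty] at hpm
      exact hpm.false
    obtain ⟨a, ha, ha0⟩ := exists_lt_of_lt_csSup hne hpm
    exact ⟨a, ha0, ha⟩
  obtain ⟨M, hM, hMp⟩ : ∃ M, M < A ∧ ∀ᵐ z ∂(volume : Measure (Hei n)), p z ≤ M := by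
    rw [pplus, essSup, Filter.limsup_eq] at hA
    have hne : {a | ∀ᵐ z ∂(volume : Measure (Hei n)), p z ≤ a}.Nonempty := hbdd
    obtain ⟨a, ha, ha0⟩ := exists_lt_of_csInf_lt hne hA
    exact ⟨a, ha0, ha⟩
  obtain ⟨z, hz⟩ := (hmp.and hMp).exists
  exact ⟨m, M, hm, hz.1.trans hz.2, hM, hmp.and hMp⟩

lemma abs_one_div_sub_one_div_le {m a b : ℝ} (hm : 0 < m) (ha : m ≤ a) (hb : m ≤ b) :
    |1 / a - 1 / b| ≤ |a - b| / m ^ 2 := by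
  have ha0 := hm.trans_le ha
  have hb0 := hm.trans_le hb
  rw [div_sub_div _ _ ha0.ne' hb0.ne', abs_div, one_mul, mul_one, abs_sub_comm,
    abs_of_pos (mul_pos ha0 hb0)]
  gcongr
  nlinarith

lemma abs_one_div_sub_one_div_le_one_div {m a b : ℝ} (hm : 0 < m) (ha : m ≤ a) (hb : m ≤ b) :
    |1 / a - 1 / b| ≤ 1 / m := by
  have h1 := one_div_le_one_div_of_le hm ha
  have h2 := one_div_le_one_div_of_le hm hb
  have h3 : 0 < 1 / a := one_div_pos.2 (hm.trans_le ha)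
  have h4 : 0 < 1 / b := one_div_pos.2 (hm.trans_le hb)
  rw [abs_le]
  constructor <;> linarith

/-- Projection to `[m, M]`. -/
def clamp (m M x : ℝ) : ℝ := max m (min M x)

lemma abs_sub_clamp_le {m M a x : ℝ} (ha : m ≤ a) (haM : a ≤ M) :
    |a - clamp m M x| ≤ |a - x| := by
  have h : a = clamp m M a := by
    rw [clamp, min_eq_right haM, max_eq_right ha]
  nth_rw 1 [h]
  unfold clamp
  refine (abs_max_sub_max_le_max _ _ _ _).trans (max_le (by simp) ?_)
  exact (abs_min_sub_min_le_max _ _ _ _).trans (max_le (by simp) le_rfl)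

/-- On balls of volume at most one, a log-Hölder exponent is close to its value at the centre. -/
lemma LogHolderLocal.close_center {p : Hei n → ℝ} (hp : LogHolderLocal p) {m M : ℝ}
    (hm : 0 < m) :
    ∃ L : ℝ, ∀ (z₀ : Hei n) (δ : ℝ), 0 < δ → ballConst n * δ ^ Q n ≤ 1 →
      ∀ z ∈ kball z₀ δ, m ≤ p z → p z ≤ M →
        |1 / p z - 1 / clamp m M (p z₀)| * |Real.log (ballConst n * δ ^ Q n)| ≤ L := by
  obtain ⟨C, hC, hp⟩ := hp
  refine ⟨1 / m * |Real.log (ballConst n)| + 1 / m * (Q n * Real.log 2) + Q n * (C / m ^ 2),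
    fun z₀ δ hδ hV z hz hmz hzM => ?_⟩
  have hQ := Q_pos n
  have hc := ballConst_pos n
  have hlog : Real.log (ballConst n * δ ^ Q n) = Real.log (ballConst n) + Q n * Real.log δ := by
    rw [Real.log_mul hc.ne' (by positivity), Real.log_rpow hδ]
  have hneg : |Real.log (ballConst n * δ ^ Q n)| ≤
      |Real.log (ballConst n)| + Q n * -Real.log δ := by
    rw [abs_of_nonpos (Real.log_nonpos (by positivity) hV), hlog]
    linarith [neg_abs_le (Real.log (ballConst n))]
  have hs := abs_one_div_sub_one_div_le_one_div hm hmz (le_max_left m (min M (p z₀)))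
  have hs' : |1 / p z - 1 / clamp m M (p z₀)| ≤ |p z - p z₀| / m ^ 2 :=
    (abs_one_div_sub_one_div_le hm hmz (le_max_left _ _)).trans
      (div_le_div_of_nonneg_right (abs_sub_clamp_le hmz hzM) (by positivity))
  change |1 / p z - 1 / clamp m M (p z₀)| ≤ 1 / m at hs
  set s := |1 / p z - 1 / clamp m M (p z₀)| with hsdef
  have hs0 : 0 ≤ s := abs_nonneg _
  have h2 : 0 ≤ Real.log 2 := Real.log_nonneg one_le_two
  have key : s * (Q n * -Real.log δ) ≤ 1 / m * (Q n * Real.log 2) + Q n * (C / m ^ 2) := by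
    rcases le_or_gt δ (1 / 2) with hδ2 | hδ2
    · have hδlog : 0 ≤ -Real.log δ := by
        have := Real.log_nonpos hδ.le (by linarith)
        linarith
      have hpz : |p z - p z₀| * -Real.log δ ≤ C := by
        rcases (knorm_nonneg (hmul (hinv z₀) z)).eq_or_lt' with h0 | h0
        · rw [eq_of_knorm_eq_zero h0]
          simpa using hC.le
        · have hle : knorm (hmul (hinv z₀) z) < δ := hz
          refine le_trans ?_ (hp z₀ z (hle.le.trans hδ2))
          rw [abs_sub_comm]
          have := Real.log_le_log h0 hle.le
          gcongr
      calc s * (Q n * -Real.log δ) ≤ |p z - p z₀| / m ^ 2 * (Q n * -Real.log δ) := by gcongr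
        _ = Q n * ((|p z - p z₀| * -Real.log δ) / m ^ 2) := by ring
        _ ≤ Q n * (C / m ^ 2) := by gcongr
        _ ≤ _ := by
          have : 0 ≤ 1 / m * (Q n * Real.log 2) := by positivity
          linarith
    · have hδlog : -Real.log δ ≤ Real.log 2 := by
        rw [← Real.log_inv]
        refine Real.log_le_log (by positivity) ?_
        rw [inv_le_comm₀ hδ two_pos]
        linarith
      calc s * (Q n * -Real.log δ) ≤ s * (Q n * Real.log 2) := by gcongr
        _ ≤ 1 / m * (Q n * Real.log 2) := by gcongr
        _ ≤ _ := by
          have : 0 ≤ Q n * (C / m ^ 2) := by positivity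
          linarith
  calc s * |Real.log (ballConst n * δ ^ Q n)|
      ≤ s * (|Real.log (ballConst n)| + Q n * -Real.log δ) := by gcongr
    _ = s * |Real.log (ballConst n)| + s * (Q n * -Real.log δ) := by ring
    _ ≤ 1 / m * |Real.log (ballConst n)| +
        (1 / m * (Q n * Real.log 2) + Q n * (C / m ^ 2)) := by gcongr
    _ = _ := by ring

/-- Away from a ball of radius `a V^ε`, an exponent with log-Hölder decay is close to its limit. -/
lemma LogDecay.close_infty {p : Hei n → ℝ} {pinf : ℝ} (hp : LogDecay p pinf) {m M a ε : ℝ}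
    (hm : 0 < m) (ha : 0 < a) (hε : 0 < ε) :
    ∃ L : ℝ, ∀ V : ℝ, 1 ≤ V → ∀ z : Hei n, a * V ^ ε ≤ knorm z → m ≤ p z → p z ≤ M →
      |1 / p z - 1 / clamp m M pinf| * |Real.log V| ≤ L := by
  obtain ⟨C, hC, hp⟩ := hp
  refine ⟨C / m ^ 2 * ((1 + |Real.log a|) / ε), fun V hV z hz hmz hzM => ?_⟩
  have hV0 : 0 < V := one_pos.trans_le hV
  have hs' : |1 / p z - 1 / clamp m M pinf| ≤ |p z - pinf| / m ^ 2 :=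
    (abs_one_div_sub_one_div_le hm hmz (le_max_left _ _)).trans
      (div_le_div_of_nonneg_right (abs_sub_clamp_le hmz hzM) (by positivity))
  have hlog1 : 1 ≤ Real.log (Real.exp 1 + knorm z) := by
    rw [Real.le_log_iff_exp_le (by have := knorm_nonneg z; positivity)]
    linarith [knorm_nonneg z]
  have hlogV : Real.log V ≤ (1 + |Real.log a|) / ε * Real.log (Real.exp 1 + knorm z) := by
    have h1 : Real.log (a * V ^ ε) ≤ Real.log (Real.exp 1 + knorm z) :=
      Real.log_le_log (by positivity) (by linarith [Real.exp_pos 1])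
    rw [Real.log_mul ha.ne' (by positivity), Real.log_rpow hV0] at h1
    rw [div_mul_eq_mul_div, le_div_iff₀ hε]
    nlinarith [neg_abs_le (Real.log a), abs_nonneg (Real.log a)]
  rw [abs_of_nonneg (Real.log_nonneg hV)]
  calc |1 / p z - 1 / clamp m M pinf| * Real.log V
      ≤ |p z - pinf| / m ^ 2 * ((1 + |Real.log a|) / ε * Real.log (Real.exp 1 + knorm z)) := by
        gcongr
        exact Real.log_nonneg hV
    _ = (|p z - pinf| * Real.log (Real.exp 1 + knorm z)) / m ^ 2 * ((1 + |Real.log a|) / ε) := by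
        ring
    _ ≤ C / m ^ 2 * ((1 + |Real.log a|) / ε) := by
        gcongr
        exact hp z

/-- Every ball has a large subset on which an exponent in `P^{log}` is close to a constant. -/
lemma IsPLog.exists_close {p : Hei n → ℝ} (hp : IsPLog p) {m M θ : ℝ}
    (hm : 0 < m) (hmM : m ≤ M) (hθ : 0 < θ)
    (hpb : ∀ᵐ z ∂(volume : Measure (Hei n)), m ≤ p z ∧ p z ≤ M) :
    ∃ L : ℝ, ∀ (z₀ : Hei n) (δ : ℝ), 0 < δ → ∃ (P : ℝ) (G : Set (Hei n)),
      m ≤ P ∧ P ≤ M ∧ MeasurableSet G ∧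
      (∀ᵐ z ∂(volume : Measure (Hei n)), z ∈ kball z₀ δ ∩ G →
        |1 / p z - 1 / P| * |Real.log (ballConst n * δ ^ Q n)| ≤ L) ∧
      (volume (kball z₀ δ \ G) = 0 ∨ (1 ≤ ballConst n * δ ^ Q n ∧
        volume (kball z₀ δ \ G) ≤ ENNReal.ofReal ((ballConst n * δ ^ Q n) ^ θ / 2))) := by
  obtain ⟨-, -, -, hloc, pinf, hdec⟩ := hp
  have hQ := Q_pos n
  have hc := ballConst_pos n
  obtain ⟨L₁, hL₁⟩ := hloc.close_center (M := M) hm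
  obtain ⟨L₂, hL₂⟩ := hdec.close_infty (M := M) (a := (2 * ballConst n)⁻¹ ^ (1 / Q n))
    (ε := θ / Q n) hm (by positivity) (by positivity)
  refine ⟨max L₁ L₂, fun z₀ δ hδ => ?_⟩
  set V := ballConst n * δ ^ Q n with hV
  rcases le_total V 1 with hV1 | hV1
  · refine ⟨clamp m M (p z₀), univ, le_max_left _ _, max_le hmM (min_le_left _ _),
      MeasurableSet.univ, ?_, by simp⟩
    filter_upwards [hpb] with z hz hzB
    exact (hL₁ z₀ δ hδ hV1 z hzB.1 hz.1 hz.2).trans (le_max_left _ _)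
  · have hV0 : 0 < V := one_pos.trans_le hV1
    set R := (2 * ballConst n)⁻¹ ^ (1 / Q n) * V ^ (θ / Q n) with hR
    have hR0 : 0 < R := by positivity
    refine ⟨clamp m M pinf, (kball he R)ᶜ, le_max_left _ _, max_le hmM (min_le_left _ _),
      (isOpen_kball he hR0).measurableSet.compl, ?_, Or.inr ⟨hV1, ?_⟩⟩
    · filter_upwards [hpb] with z hz hzB
      refine (hL₂ V hV1 z ?_ hz.1 hz.2).trans (le_max_right _ _)
      have hzG := hzB.2
      rwa [kball_he, mem_compl_iff, mem_ofPred_eq, not_lt] at hzG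
    · have hsub : kball z₀ δ \ (kball he R)ᶜ ⊆ kball he R := by
        intro z hz
        simpa using hz.2
      refine (measure_mono hsub).trans_eq ?_
      rw [volume_kball he hR0, hR, Real.mul_rpow (by positivity) (by positivity),
        ← Real.rpow_mul (by positivity), ← Real.rpow_mul hV0.le, one_div_mul_cancel hQ.ne',
        div_mul_cancel₀ _ hQ.ne', Real.rpow_one]
      congr 1
      field_simp

/-- For `0 < α < Q`, `p(·) ∈ P^{log}` with `0 < p₋ ≤ p₊ < Q/α` and
`1/q(·) = 1/p(·) − α/Q`, one has
`‖χ_B‖_{L^{q(·)}} ≈ |B|^{−α/Q} ‖χ_B‖_{L^{p(·)}}` uniformly over all `ρ`-balls `B`. -/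
theorem chiNorm_q_equiv (n : ℕ) (α : ℝ) (hα0 : 0 < α) (hαQ : α < Q n)
    (p q : Hei n → ℝ) (hp : IsPLog p) (h2 : pplus p * α < Q n)
    (hq : ∀ z, 1 / q z = 1 / p z - α / Q n) :
    ∃ c₁ > (0:ℝ), ∃ c₂ > (0:ℝ), ∀ (z₀ : Hei n) (δ : ℝ), 0 < δ →
      c₁ * ((volume (kball z₀ δ)).toReal ^ (-(α / Q n)) * chiNorm p (kball z₀ δ)) ≤
        chiNorm q (kball z₀ δ) ∧
      chiNorm q (kball z₀ δ) ≤
        c₂ * ((volume (kball z₀ δ)).toReal ^ (-(α / Q n)) * chiNorm p (kball z₀ δ)) := by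
  have hQ := Q_pos n
  obtain ⟨m, M, hm, hmM, hMA, hpb⟩ := hp.exists_bounds ((lt_div_iff₀ hα0).2 h2)
  have hM0 : 0 < M := hm.trans_le hmM
  have hMα : α / Q n < 1 / M := by
    rw [div_lt_div_iff₀ hQ hM0]
    have := (lt_div_iff₀ hα0).1 hMA
    linarith
  have hα' : 0 < α / Q n := by positivity
  set N : ℝ := (1 / M - α / Q n)⁻¹ with hN
  have hshift : ∀ a b : ℝ, m ≤ a → a ≤ M → 1 / b = 1 / a - α / Q n → a ≤ b ∧ b ≤ N := by
    intro a b ha haM hb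
    have ha0 := hm.trans_le ha
    have h1 : 1 / M ≤ 1 / a := one_div_le_one_div_of_le ha0 haM
    have hb0 : 0 < b := by
      rw [← one_div_pos, hb]; linarith
    refine ⟨(one_div_le_one_div hb0 ha0).1 (by linarith), ?_⟩
    rw [hN, le_inv_comm₀ hb0 (by linarith), ← one_div, hb]
    linarith
  have hMN : M ≤ N := (hshift M N hmM le_rfl (by rw [hN, one_div, inv_inv])).1
  have hpN : ∀ᵐ z ∂(volume : Measure (Hei n)), m ≤ p z ∧ p z ≤ N :=
    hpb.mono fun z hz => ⟨hz.1, hz.2.trans hMN⟩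
  have hqN : ∀ᵐ z ∂(volume : Measure (Hei n)), m ≤ q z ∧ q z ≤ N := by
    filter_upwards [hpb] with z hz
    have := hshift _ _ hz.1 hz.2 (hq z)
    exact ⟨hz.1.trans this.1, this.2⟩
  obtain ⟨L, hL⟩ := hp.exists_close (θ := m / N) hm hmM (div_pos hm (hM0.trans_le hMN)) hpb
  set c := (Real.exp (-(N * L)) / 4) ^ (1 / m) with hc
  set C := (Real.exp (N * L) + 1) ^ (1 / m) with hC
  have hc0 : 0 < c := by positivity
  have hC0 : 0 < C := by positivity
  refine ⟨c / C, by positivity, C / c, by positivity, fun z₀ δ hδ => ?_⟩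
  obtain ⟨P, G, hmP, hPM, hG, hclose, hbad⟩ := hL z₀ δ hδ
  have hV : volume (kball z₀ δ) = ENNReal.ofReal (ballConst n * δ ^ Q n) := volume_kball z₀ hδ
  have hV0 : 0 < ballConst n * δ ^ Q n := mul_pos (ballConst_pos n) (by positivity)
  have hB : MeasurableSet (kball z₀ δ) := (isOpen_kball z₀ hδ).measurableSet
  set V := ballConst n * δ ^ Q n
  have hS : 1 / (1 / P - α / Q n)⁻¹ = 1 / P - α / Q n := by rw [one_div, inv_inv]
  have hSb := hshift P _ hmP hPM hS
  obtain ⟨hp1, hp2⟩ := chiNorm_equiv_of_close hm hpN hmP (hPM.trans hMN) hV0 hB hG hV hclose hbad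
  obtain ⟨hq1, hq2⟩ := chiNorm_equiv_of_close (L := L) hm hqN (hmP.trans hSb.1) hSb.2 hV0 hB hG hV
    (by
      filter_upwards [hclose] with z hz hzB
      rw [hS, hq z, sub_sub_sub_cancel_right]
      exact hz hzB) hbad
  rw [hS, sub_eq_neg_add, Real.rpow_add hV0, ← hc] at hq1
  rw [hS, sub_eq_neg_add, Real.rpow_add hV0, ← hC] at hq2
  rw [← hc] at hp1
  rw [← hC] at hp2
  rw [hV, ENNReal.toReal_ofReal hV0.le]
  have hW : 0 < V ^ (-(α / Q n)) := by positivity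
  constructor
  · refine le_trans ?_ hq1
    calc c / C * (V ^ (-(α / Q n)) * chiNorm p (kball z₀ δ))
        ≤ c / C * (V ^ (-(α / Q n)) * (C * V ^ (1 / P))) := by gcongr
      _ = c * (V ^ (-(α / Q n)) * V ^ (1 / P)) := by field_simp
  · refine hq2.trans ?_
    calc C * (V ^ (-(α / Q n)) * V ^ (1 / P))
        = C / c * (V ^ (-(α / Q n)) * (c * V ^ (1 / P))) := by field_simp
      _ ≤ C / c * (V ^ (-(α / Q n)) * chiNorm p (kball z₀ δ)) := by gcongr

end Heisenberg
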